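/- (Inequality lemma) Let ρ : A → P be a basic scaling. (a) If ρ(x) ≤ ρ(y), x ∨ z = 1, y ∨ w = 1, and ρ(z) = ρ(w), then ρ(x ∧ z) ≤ ρ(y ∧ w). (b) If ρ(x) ≤ ρ(y), z ≤ x, w ≤ y, and ρ(z) = ρ(w), then ρ(x ∧ zᶜ) ≤ ρ(y ∧ wᶜ). Both statements remain true when < replaces ≤ in hypothesis and conclusion. (In sum-notation: ζ ≤ η implies ζ ⊕ θ ≤ η ⊕ θ and ζ − θ ≤ η − θ whenever the operations exist.) -/

import Mathlib

/-- A *basic scaling* is a strictly increasing map from a Boolean algebra to a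
partially ordered set that preserves relative complementation. -/
structure IsBasicScaling {A P : Type*} [BooleanAlgebra A] [PartialOrder P]
    (ρ : A → P) : Prop where
  mono : ∀ x y : A, x < y → ρ x < ρ y
  relcomp_lt : ∀ a b x y : A, a ≤ x → x ≤ b → a ≤ y → y ≤ b →
      ρ x < ρ y → ρ (a ⊔ (b ⊓ yᶜ)) < ρ (a ⊔ (b ⊓ xᶜ))
  relcomp_eq : ∀ a b x y : A, a ≤ x → x ≤ b → a ≤ y → y ≤ b →
      ρ x = ρ y → ρ (a ⊔ (b ⊓ xᶜ)) = ρ (a ⊔ (b ⊓ yᶜ))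

/-- A basic scaling is *divided* if whenever `ρ x < ρ y` there is `y₁ < y`
with `ρ y₁ = ρ x`. -/
def Divided {A P : Type*} [BooleanAlgebra A] [PartialOrder P] (ρ : A → P) : Prop :=
  ∀ x y : A, ρ x < ρ y → ∃ y₁, y₁ < y ∧ ρ y₁ = ρ x

namespace IsBasicScaling

variable {A P : Type*} [BooleanAlgebra A] [PartialOrder P] {ρ : A → P}

theorem compl_lt (h : IsBasicScaling ρ) {x y : A} (hxy : ρ x < ρ y) : ρ yᶜ < ρ xᶜ := by
  simpa using h.relcomp_lt ⊥ ⊤ x y bot_le le_top bot_le le_top hxy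

theorem compl_eq (h : IsBasicScaling ρ) {x y : A} (hxy : ρ x = ρ y) : ρ xᶜ = ρ yᶜ := by
  simpa using h.relcomp_eq ⊥ ⊤ x y bot_le le_top bot_le le_top hxy

theorem sup_right_lt (h : IsBasicScaling ρ) {x y z : A} (hx : Disjoint x z)
    (hy : Disjoint y z) (hxy : ρ x < ρ y) : ρ (x ⊔ z) < ρ (y ⊔ z) := by
  have := h.compl_lt
    (h.relcomp_lt ⊥ zᶜ x y bot_le hx.le_compl_right bot_le hy.le_compl_right hxy)
  simpa [compl_inf, sup_comm] using this

theorem sup_right_eq (h : IsBasicScaling ρ) {x y z : A} (hx : Disjoint x z)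
    (hy : Disjoint y z) (hxy : ρ x = ρ y) : ρ (x ⊔ z) = ρ (y ⊔ z) := by
  have := h.compl_eq
    (h.relcomp_eq ⊥ zᶜ x y bot_le hx.le_compl_right bot_le hy.le_compl_right hxy)
  simpa [compl_inf, sup_comm] using this

/-- Sums of disjoint elements are strictly monotone in one summand. -/
theorem sup_lt_sup (h : IsBasicScaling ρ) {x y z w : A} (hxz : Disjoint x z)
    (hyw : Disjoint y w) (hxy : ρ x < ρ y) (hzw : ρ z = ρ w) :
    ρ (x ⊔ z) < ρ (y ⊔ w) := by
  have hlt : ρ (x ⊔ z \ y) < ρ (y ⊔ z \ y) :=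
    h.sup_right_lt (hxz.mono_right sdiff_le) disjoint_sdiff_self_right hxy
  have heq : ρ (z ⊔ y \ z) = ρ (w ⊔ y \ z) :=
    h.sup_right_eq disjoint_sdiff_self_right (hyw.symm.mono_right sdiff_le) hzw
  rw [sup_sdiff_self_right, sup_comm y z, ← sup_sdiff_self_right z y, heq] at hlt
  have hsum := h.sup_right_lt (z := z ⊓ y)
    (disjoint_sup_left.2 ⟨hxz.mono_right inf_le_left,
      disjoint_sdiff_self_left.mono_right inf_le_right⟩)
    (disjoint_sup_left.2 ⟨hyw.symm.mono_right inf_le_right,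
      disjoint_sdiff_self_left.mono_right inf_le_left⟩) hlt
  rwa [sup_assoc, sup_comm (z \ y), sup_inf_sdiff, sup_assoc, inf_comm z y,
    sup_comm (y \ z), sup_inf_sdiff, sup_comm w y] at hsum

/-- Sums of disjoint elements are well defined on values. -/
theorem sup_eq_sup (h : IsBasicScaling ρ) {x y z w : A} (hxz : Disjoint x z)
    (hyw : Disjoint y w) (hxy : ρ x = ρ y) (hzw : ρ z = ρ w) :
    ρ (x ⊔ z) = ρ (y ⊔ w) := by
  have hxy' : ρ (x ⊔ z \ y) = ρ (y ⊔ z \ y) :=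
    h.sup_right_eq (hxz.mono_right sdiff_le) disjoint_sdiff_self_right hxy
  have hzw' : ρ (z ⊔ y \ z) = ρ (w ⊔ y \ z) :=
    h.sup_right_eq disjoint_sdiff_self_right (hyw.symm.mono_right sdiff_le) hzw
  rw [sup_sdiff_self_right, sup_comm y z, ← sup_sdiff_self_right z y, hzw'] at hxy'
  have hsum := h.sup_right_eq (z := z ⊓ y)
    (disjoint_sup_left.2 ⟨hxz.mono_right inf_le_left,
      disjoint_sdiff_self_left.mono_right inf_le_right⟩)
    (disjoint_sup_left.2 ⟨hyw.symm.mono_right inf_le_right,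
      disjoint_sdiff_self_left.mono_right inf_le_left⟩) hxy'
  rwa [sup_assoc, sup_comm (z \ y), sup_inf_sdiff, sup_assoc, inf_comm z y,
    sup_comm (y \ z), sup_inf_sdiff, sup_comm w y] at hsum

theorem sdiff_lt_sdiff (h : IsBasicScaling ρ) {x y z w : A} (hzx : z ≤ x) (hwy : w ≤ y)
    (hxy : ρ x < ρ y) (hzw : ρ z = ρ w) : ρ (x ⊓ zᶜ) < ρ (y ⊓ wᶜ) := by
  have := h.compl_lt (h.sup_lt_sup (disjoint_compl_left.mono_right hwy)
    (disjoint_compl_left.mono_right hzx) (h.compl_lt hxy) hzw.symm)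
  simpa [compl_sup] using this

theorem sdiff_eq_sdiff (h : IsBasicScaling ρ) {x y z w : A} (hzx : z ≤ x) (hwy : w ≤ y)
    (hxy : ρ x = ρ y) (hzw : ρ z = ρ w) : ρ (x ⊓ zᶜ) = ρ (y ⊓ wᶜ) := by
  have := h.compl_eq (h.sup_eq_sup (disjoint_compl_left.mono_right hzx)
    (disjoint_compl_left.mono_right hwy) (h.compl_eq hxy) hzw)
  simpa [compl_sup] using this

theorem inf_lt_inf (h : IsBasicScaling ρ) {x y z w : A} (hxz : x ⊔ z = ⊤) (hyw : y ⊔ w = ⊤)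
    (hxy : ρ x < ρ y) (hzw : ρ z = ρ w) : ρ (x ⊓ z) < ρ (y ⊓ w) := by
  simpa using h.sdiff_lt_sdiff
    (codisjoint_iff_compl_le_left.1 (codisjoint_iff.2 hxz))
    (codisjoint_iff_compl_le_left.1 (codisjoint_iff.2 hyw)) hxy (h.compl_eq hzw)

theorem inf_eq_inf (h : IsBasicScaling ρ) {x y z w : A} (hxz : x ⊔ z = ⊤) (hyw : y ⊔ w = ⊤)
    (hxy : ρ x = ρ y) (hzw : ρ z = ρ w) : ρ (x ⊓ z) = ρ (y ⊓ w) := by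
  simpa using h.sdiff_eq_sdiff
    (codisjoint_iff_compl_le_left.1 (codisjoint_iff.2 hxz))
    (codisjoint_iff_compl_le_left.1 (codisjoint_iff.2 hyw)) hxy (h.compl_eq hzw)

end IsBasicScaling

theorem stmt_9 {A P : Type*} [BooleanAlgebra A] [PartialOrder P] (ρ : A → P)
    (h : IsBasicScaling ρ) (x y z w : A) :
    (ρ x ≤ ρ y → x ⊔ z = ⊤ → y ⊔ w = ⊤ → ρ z = ρ w → ρ (x ⊓ z) ≤ ρ (y ⊓ w)) ∧
    (ρ x < ρ y → x ⊔ z = ⊤ → y ⊔ w = ⊤ → ρ z = ρ w → ρ (x ⊓ z) < ρ (y ⊓ w)) ∧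
    (ρ x ≤ ρ y → z ≤ x → w ≤ y → ρ z = ρ w → ρ (x ⊓ zᶜ) ≤ ρ (y ⊓ wᶜ)) ∧
    (ρ x < ρ y → z ≤ x → w ≤ y → ρ z = ρ w → ρ (x ⊓ zᶜ) < ρ (y ⊓ wᶜ)) := by
  refine ⟨fun hxy hxz hyw hzw => ?_, fun hxy hxz hyw hzw => h.inf_lt_inf hxz hyw hxy hzw,
    fun hxy hzx hwy hzw => ?_, fun hxy hzx hwy hzw => h.sdiff_lt_sdiff hzx hwy hxy hzw⟩
  · rcases hxy.lt_or_eq with hlt | heq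
    · exact (h.inf_lt_inf hxz hyw hlt hzw).le
    · exact (h.inf_eq_inf hxz hyw heq hzw).le
  · rcases hxy.lt_or_eq with hlt | heq
    · exact (h.sdiff_lt_sdiff hzx hwy hlt hzw).le
    · exact (h.sdiff_eq_sdiff hzx hwy heq hzw).le
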